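/- Let a < 0 and b ∈ ℝ, define φ(x) = −(3/2)·sech²(x/(2√(−a))), set c₀ := 7/9 + (2/9)·(b/(−a)) and g := (φ − b·φ'') − c₀·(a·φ'' + φ). Then ∫_ℝ g(x)² dx = (2/5)·√(−a)·( b/(−a) − 1 )². In particular g vanishes identically if and only if b = −a. -/

import Mathlib

open MeasureTheory

open Filter Topology

theorem one_div_cosh_sq (y : ℝ) : (1 / Real.cosh y) ^ 2 = 1 - Real.tanh y ^ 2 := by
  have h := (Real.cosh_pos y).ne'
  have h2 := Real.cosh_sq y
  rw [Real.tanh_eq_sinh_div_cosh]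
  field_simp
  linarith

theorem hasDerivAt_real_tanh (y : ℝ) : HasDerivAt Real.tanh (1 - Real.tanh y ^ 2) y := by
  have h := (Real.cosh_pos y).ne'
  have hd := (Real.hasDerivAt_sinh y).div (Real.hasDerivAt_cosh y) h
  have hfun : Real.tanh = Real.sinh / Real.cosh := by
    ext z
    exact Real.tanh_eq_sinh_div_cosh z
  rw [hfun]
  refine hd.congr_deriv ?_
  simp only [Pi.div_apply]
  field_simp

theorem tendsto_real_tanh_atTop : Tendsto Real.tanh atTop (𝓝 1) := by
  have hfun : Real.tanh = fun x => 1 - 2 / (Real.exp (2 * x) + 1) := by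
    ext x
    have hx := Real.exp_pos x
    rw [Real.tanh_eq, Real.exp_neg, two_mul, Real.exp_add]
    field_simp
    ring
  rw [hfun]
  have h : Tendsto (fun x : ℝ => Real.exp (2 * x) + 1) atTop atTop :=
    tendsto_atTop_add_const_right _ _
      (Real.tendsto_exp_atTop.comp (tendsto_id.const_mul_atTop two_pos))
  simpa using (h.const_div_atTop 2).const_sub 1

theorem tendsto_real_tanh_atBot : Tendsto Real.tanh atBot (𝓝 (-1)) := by
  have h := (tendsto_real_tanh_atTop.comp tendsto_neg_atBot_atTop).neg
  refine h.congr fun x => ?_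
  simp [Real.tanh_neg]

theorem integral_eq_sub_of_hasDerivAt_of_nonneg {f f' : ℝ → ℝ} {m n : ℝ}
    (hderiv : ∀ x, HasDerivAt f (f' x) x) (hcont : Continuous f') (hpos : ∀ x, 0 ≤ f' x)
    (hbot : Tendsto f atBot (𝓝 m)) (htop : Tendsto f atTop (𝓝 n)) :
    ∫ x, f' x = n - m := by
  refine integral_of_hasDerivAt_of_tendsto hderiv ?_ hbot htop
  refine integrable_of_intervalIntegral_norm_tendsto (n - m) (a := fun i : ℝ => -i)
    (b := fun i : ℝ => i) (l := atTop) (fun i => ?_) tendsto_neg_atTop_atBot tendsto_id ?_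
  · exact (hcont.integrableOn_Icc).mono_set Set.Ioc_subset_Icc_self
  · refine (htop.sub (hbot.comp tendsto_neg_atTop_atBot)).congr fun i => ?_
    simp only [Real.norm_of_nonneg (hpos _), Function.comp_apply]
    exact (intervalIntegral.integral_eq_sub_of_hasDerivAt (fun x _ => hderiv x)
      (hcont.intervalIntegrable _ _)).symm

theorem integral_one_sub_tanh_sq_mul_sq :
    ∫ y : ℝ, ((1 - Real.tanh y ^ 2) * (7 * Real.tanh y ^ 2 - 1)) ^ 2 = 16 / 5 := by
  let P : ℝ → ℝ := fun t => t - 5 * t ^ 3 + 63 / 5 * t ^ 5 - 7 * t ^ 7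
  have hP (t : ℝ) : HasDerivAt P ((1 - t ^ 2) * (7 * t ^ 2 - 1) ^ 2) t := by
    have h := ((((hasDerivAt_id t).sub (((hasDerivAt_id t).pow 3).const_mul 5)).add
      (((hasDerivAt_id t).pow 5).const_mul (63 / 5))).sub (((hasDerivAt_id t).pow 7).const_mul 7))
    refine h.congr_deriv ?_
    simp only [id]
    push_cast
    ring
  have hcont : Continuous Real.tanh :=
    continuous_iff_continuousAt.2 fun y => (hasDerivAt_real_tanh y).continuousAt
  rw [integral_eq_sub_of_hasDerivAt_of_nonneg (f := P ∘ Real.tanh) (m := P (-1)) (n := P 1)]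
  · norm_num [P]
  · intro y
    refine ((hP _).comp y (hasDerivAt_real_tanh y)).congr_deriv ?_
    ring
  · fun_prop
  · intro y
    positivity
  · exact (hP _).continuousAt.tendsto.comp tendsto_real_tanh_atBot
  · exact (hP _).continuousAt.tendsto.comp tendsto_real_tanh_atTop

theorem hasDerivAt_tanh_div (k x : ℝ) :
    HasDerivAt (fun x => Real.tanh (x / k)) ((1 - Real.tanh (x / k) ^ 2) / k) x := by
  refine ((hasDerivAt_real_tanh (x / k)).comp x ((hasDerivAt_id x).div_const k)).congr_deriv ?_
  ring

theorem deriv_deriv_one_sub_tanh_div_sq (c k : ℝ) :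
    deriv (deriv fun x => c * (1 - Real.tanh (x / k) ^ 2)) = fun x =>
      c * (1 - Real.tanh (x / k) ^ 2) * (6 * Real.tanh (x / k) ^ 2 - 2) / k ^ 2 := by
  have h1 : deriv (fun x => c * (1 - Real.tanh (x / k) ^ 2)) = fun x =>
      -2 * c / k * (Real.tanh (x / k) - Real.tanh (x / k) ^ 3) := by
    ext x
    refine HasDerivAt.deriv ?_
    refine ((((hasDerivAt_tanh_div k x).pow 2).const_sub 1).const_mul c).congr_deriv ?_
    push_cast
    ring
  rw [h1]
  ext x
  refine HasDerivAt.deriv ?_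
  refine (((hasDerivAt_tanh_div k x).sub ((hasDerivAt_tanh_div k x).pow 3)).const_mul
    (-2 * c / k)).congr_deriv ?_
  push_cast
  ring

theorem stmt_14 (a b : ℝ) (ha : a < 0) (φ g : ℝ → ℝ) (c₀ : ℝ)
    (hφ : φ = fun x => -(3/2) * (1 / Real.cosh (x / (2 * Real.sqrt (-a))))^2)
    (hc₀ : c₀ = 7/9 + (2/9) * (b / (-a)))
    (hg : g = fun x => (φ x - b * deriv (deriv φ) x)
        - c₀ * (a * deriv (deriv φ) x + φ x)) :
    (∫ x : ℝ, (g x)^2) = (2/5) * Real.sqrt (-a) * (b / (-a) - 1)^2 ∧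
    ((∀ x : ℝ, g x = 0) ↔ b = -a) := by
  have hs : 0 < Real.sqrt (-a) := Real.sqrt_pos.2 (by linarith)
  have hs2 : a = -Real.sqrt (-a) ^ 2 := by
    rw [Real.sq_sqrt (by linarith)]
    ring
  set s := Real.sqrt (-a)
  let T : ℝ → ℝ := fun x => Real.tanh (x / (2 * s))
  have hg' : g = fun x =>
      (b / (-a) - 1) / 4 * ((1 - T x ^ 2) * (7 * T x ^ 2 - 1)) := by
    simp only [one_div_cosh_sq] at hφ
    rw [hg, hφ, deriv_deriv_one_sub_tanh_div_sq, hc₀, hs2]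
    ext x
    simp only [T]
    field_simp
    ring
  constructor
  · simp only [hg', mul_pow _ _ 2, integral_const_mul, T]
    simp only [← mul_pow]
    rw [Measure.integral_comp_div
      (fun y => ((1 - Real.tanh y ^ 2) * (7 * Real.tanh y ^ 2 - 1)) ^ 2) (2 * s),
      integral_one_sub_tanh_sq_mul_sq, abs_of_pos (by positivity), smul_eq_mul]
    ring
  · have hb : b / (-a) - 1 = 0 ↔ b = -a := by
      rw [sub_eq_zero, div_eq_one_iff_eq (by linarith)]
    rw [← hb]
    constructor
    · intro h
      have h0 := h 0
      simp only [hg', T, zero_div, Real.tanh_zero] at h0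
      linarith
    · intro h x
      simp [hg', h]
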